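/- arXiv:2603.20699 — 6 statements merged into one kernel-verified Lean document; each statement's English description precedes it below -/
import Mathlib

section
/- Let q be a prime power, m ≥ 1, and u, v ∈ F_q^m. The number of m×m Toeplitz matrices A over F_q such that uA = v (equivalently, such that the vector (u, v) belongs to the double Toeplitz code C(A)) equals q^{2m−1} if u = 0 and v = 0; equals 0 if u = 0 and v ≠ 0; and equals q^{m−1} if u ≠ 0. -/
open Matrix

/-- An `m × m` matrix is Toeplitz if its entries are constant along diagonals. -/
def IsToeplitz {m : ℕ} {F : Type*} (A : Matrix (Fin m) (Fin m) F) : Prop :=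
  ∀ i j i' j' : Fin m, (i : ℕ) + (j' : ℕ) = (i' : ℕ) + (j : ℕ) → A i j = A i' j'

/-- The double Toeplitz code `C(A) = {(x, xA) : x ∈ F^m}`. -/
def DTcode {m : ℕ} {F : Type*} [Field F] (A : Matrix (Fin m) (Fin m) F) :
    Set (Fin m ⊕ Fin m → F) :=
  {c | ∃ x : Fin m → F, c = Sum.elim x (Matrix.vecMul x A)}

/-- The Hamming weight of a vector: the number of nonzero coordinates. -/
noncomputable def wt {ι : Type*} [Fintype ι] {F : Type*} [Zero F] (v : ι → F) : ℕ :=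
  Nat.card {i // v i ≠ 0}


/-- Toeplitz matrix from its sequence of diagonal values. -/
def toepOf {F : Type*} (n : ℕ) (a : Fin (2 * n + 1) → F) : Matrix (Fin (n + 1)) (Fin (n + 1)) F :=
  fun i j => a ⟨(i : ℕ) + n - j, by omega⟩

theorem toepOf_injective {F : Type*} (n : ℕ) :
    Function.Injective (toepOf (F := F) n) := by
  intro a b h
  funext k
  have hk := k.2
  by_cases hkn : (k : ℕ) ≤ n
  · have := congrFun (congrFun h ⟨0, by omega⟩) ⟨n - k, by omega⟩
    simp only [toepOf] at this
    convert this using 2 <;> (apply Fin.ext; simp; omega)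
  · have := congrFun (congrFun h ⟨k - n, by omega⟩) ⟨0, by omega⟩
    simp only [toepOf] at this
    convert this using 2 <;> (apply Fin.ext; simp; omega)

theorem isToeplitz_iff {F : Type*} (n : ℕ) (A : Matrix (Fin (n + 1)) (Fin (n + 1)) F) :
    IsToeplitz A ↔ ∃ a, toepOf n a = A := by
  constructor
  · intro h
    refine ⟨fun k => A ⟨k - n, by omega⟩ ⟨n - k, by omega⟩, ?_⟩
    funext i j
    apply h
    have := i.2
    have := j.2
    simp only
    omega
  · rintro ⟨a, rfl⟩ i j i' j' h
    simp only [toepOf]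
    congr 2
    omega

/-- The map sending diagonal values to `uA`, as a linear map. -/
def toepLin {F : Type*} [Field F] (n : ℕ) (u : Fin (n + 1) → F) :
    (Fin (2 * n + 1) → F) →ₗ[F] (Fin (n + 1) → F) where
  toFun a := Matrix.vecMul u (toepOf n a)
  map_add' a b := by
    rw [← Matrix.vecMul_add]; rfl
  map_smul' c a := by
    simp only [RingHom.id_apply]
    rw [← Matrix.vecMul_smul]; rfl

open Polynomial in
theorem toepLin_surjective {F : Type*} [Field F] (n : ℕ) (u : Fin (n + 1) → F) (hu : u ≠ 0) :
    Function.Surjective (toepLin n u) := by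
  rw [← LinearMap.range_eq_top]
  by_contra hne
  obtain ⟨f, hf, hle⟩ := Submodule.exists_le_ker_of_lt_top _ (lt_top_iff_ne_top.mpr hne)
  set w : Fin (n + 1) → F := fun j => f (Pi.single j 1) with hw
  have hfx : ∀ x, f x = ∑ j, x j * w j := by
    intro x
    conv_lhs => rw [pi_eq_sum_univ' x]
    simp [hw, map_sum]
  let P : F[X] := ∑ i, C (u i) * X ^ (i : ℕ)
  let Q : F[X] := ∑ j, C (w j) * X ^ (n - (j : ℕ))
  have hPQ : P * Q = 0 := by
    ext k
    simp only [P, Q, Finset.sum_mul_sum, finsetSum_coeff, coeff_zero]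
    by_cases hk : k < 2 * n + 1
    · have h0 : f (toepLin n u (Pi.single ⟨k, hk⟩ 1)) = 0 := hle ⟨_, rfl⟩
      rw [hfx] at h0
      rw [← h0, Finset.sum_comm]
      refine Finset.sum_congr rfl fun j _ => ?_
      simp only [toepLin, LinearMap.coe_mk, AddHom.coe_mk, Matrix.vecMul, dotProduct,
        Finset.sum_mul]
      refine Finset.sum_congr rfl fun i _ => ?_
      have hj := j.2
      have e : C (u i) * X ^ (i : ℕ) * (C (w j) * X ^ (n - (j : ℕ)))
          = C (u i * w j) * X ^ ((i : ℕ) + n - j) := by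
        rw [show (i : ℕ) + n - j = i + (n - j) by omega, pow_add, C_mul]; ring
      rw [e, coeff_C_mul_X_pow]
      simp only [toepOf, Pi.single_apply, Fin.mk.injEq]
      by_cases h : k = (i : ℕ) + n - j
      · rw [if_pos h, if_pos h.symm]; ring
      · rw [if_neg h, if_neg (Ne.symm h)]; ring
    · refine Finset.sum_eq_zero fun i _ => Finset.sum_eq_zero fun j _ => ?_
      have e : C (u i) * X ^ (i : ℕ) * (C (w j) * X ^ (n - (j : ℕ)))
          = C (u i * w j) * X ^ ((i : ℕ) + (n - j)) := by
        rw [pow_add, C_mul]; ring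
      have hi := i.2
      rw [e, coeff_C_mul_X_pow, if_neg (by omega)]
  rcases mul_eq_zero.mp hPQ with h | h
  · apply hu
    funext i
    have := congrArg (fun p => coeff p (i : ℕ)) h
    simpa [P, finsetSum_coeff, coeff_X_pow, Fin.val_inj] using this
  · apply hf
    have hw0 : ∀ j, w j = 0 := by
      intro j
      have := congrArg (fun p => coeff p (n - (j : ℕ))) h
      simp only [Q, finsetSum_coeff, coeff_C_mul_X_pow, coeff_zero] at this
      rw [Finset.sum_eq_single j] at this
      · simpa using this
      · intro b _ hb
        have := b.2
        have := j.2
        have : (b : ℕ) ≠ j := fun h => hb (Fin.ext h)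
        rw [if_neg (by omega)]
      · simp
    ext x
    simpa [hw] using hw0 x

theorem ncard_toep {F : Type*} [Field F] (n : ℕ) (u v : Fin (n + 1) → F) :
    {A : Matrix (Fin (n + 1)) (Fin (n + 1)) F | IsToeplitz A ∧ Matrix.vecMul u A = v}.ncard
      = {a | toepLin n u a = v}.ncard := by
  rw [← Set.ncard_image_of_injective _ (toepOf_injective (F := F) n)]
  congr 1
  ext A
  simp only [Set.mem_ofPred_eq, Set.mem_image, isToeplitz_iff]
  constructor
  · rintro ⟨⟨a, rfl⟩, h⟩
    exact ⟨a, h, rfl⟩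
  · rintro ⟨a, h, rfl⟩
    exact ⟨⟨a, rfl⟩, h⟩

theorem ncard_fiber {F : Type*} [Field F] [Fintype F] (n : ℕ) (u v : Fin (n + 1) → F)
    (hu : u ≠ 0) : {a | toepLin n u a = v}.ncard = Fintype.card F ^ n := by
  classical
  have hs := toepLin_surjective n u hu
  have key : ∀ w, (Finset.univ.filter fun a => toepLin n u a = w).card
      = (Finset.univ.filter fun a => toepLin n u a = v).card := by
    intro w
    exact AddMonoidHom.card_fiber_eq_of_mem_range (toepLin n u).toAddMonoidHom (hs w) (hs v)
  have tot := Finset.card_eq_sum_card_fiberwise (f := toepLin n u)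
    (s := Finset.univ) (t := Finset.univ) (by intro x _; simp)
  rw [Finset.sum_congr rfl (fun w _ => key w)] at tot
  simp only [Finset.card_univ, Fintype.card_pi, Finset.prod_const, Fintype.card_fin,
    Finset.sum_const, smul_eq_mul] at tot
  rw [Set.ncard_eq_toFinset_card']
  have hq : 0 < Fintype.card F ^ (n + 1) := pow_pos Fintype.card_pos _
  have e : Fintype.card F ^ (2 * n + 1) = Fintype.card F ^ (n + 1) * Fintype.card F ^ n := by
    rw [← pow_add]; congr 1; omega
  have := Nat.eq_of_mul_eq_mul_left hq (e.symm.trans tot)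
  rw [this]
  congr 1
  ext a
  simp

open scoped Classical

/-- The number of `m × m` Toeplitz matrices `A` over a field with `q` elements
such that `uA = v` is `q^(2m-1)` if `u = 0, v = 0`; `0` if `u = 0, v ≠ 0`;
and `q^(m-1)` if `u ≠ 0`. -/
theorem stmt1 (q : ℕ) (hq : IsPrimePow q) (F : Type*) [Field F] [Fintype F]
    (hF : Fintype.card F = q) (m : ℕ) (hm : 1 ≤ m) (u v : Fin m → F) :
    {A : Matrix (Fin m) (Fin m) F | IsToeplitz A ∧ Matrix.vecMul u A = v}.ncard =
      if u = 0 then (if v = 0 then q ^ (2 * m - 1) else 0) else q ^ (m - 1) := by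
  obtain ⟨n, rfl⟩ : ∃ n, m = n + 1 := ⟨m - 1, by omega⟩
  subst hF
  rw [ncard_toep]
  split_ifs with hu hv
  · subst hu hv
    have : {a | toepLin n (0 : Fin (n + 1) → F) a = 0} = Set.univ := by
      ext a
      simp [toepLin]
    rw [this, Set.ncard_univ, Nat.card_eq_fintype_card]
    simp only [Fintype.card_pi, Finset.prod_const, Finset.card_univ, Fintype.card_fin]
    congr 1
  · subst hu
    have : {a | toepLin n (0 : Fin (n + 1) → F) a = v} = ∅ := by
      ext a
      simp [toepLin, Ne.symm hv]
    rw [this, Set.ncard_empty]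
  · exact ncard_fiber n u v hu
end

section
/- Let q be a prime power, m ≥ 1, and n = 2m. For every integer j with 1 ≤ j ≤ n, the total number of codewords of weight exactly j, summed over all m×m Toeplitz matrices A over F_q (i.e., Σ_A #{c ∈ C(A) : wt(c) = j}), equals q^{m−1}·(binom(n, j) − binom(m, j))·(q−1)^j if 1 ≤ j ≤ m, and equals q^{m−1}·binom(n, j)·(q−1)^j if m < j ≤ n. Moreover, the total number of codewords of weight 0 over all such A is q^{n−1}. -/
open Matrix

open scoped Classical

/-- The Toeplitz matrix with given diagonals. -/
def toep (F : Type*) (k : ℕ) (t : Fin (2 * k + 1) → F) : Matrix (Fin (k + 1)) (Fin (k + 1)) F :=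
  fun i j => t ⟨i.val + k - j.val, by have := i.isLt; have := j.isLt; omega⟩

theorem toep_isToeplitz (F : Type*) (k : ℕ) (t : Fin (2 * k + 1) → F) :
    IsToeplitz (toep F k t) := by
  intro i j i2 j2 h
  unfold toep
  congr 2
  have := i.isLt; have := j.isLt; have := i2.isLt; have := j2.isLt
  omega

theorem toep_inj (F : Type*) (k : ℕ) : Function.Injective (toep F k) := by
  intro s t h
  funext ⟨d, hd⟩
  by_cases hdk : d ≤ k
  · have := congrFun (congrFun h ⟨0, by omega⟩) ⟨k - d, by omega⟩
    simp only [toep] at this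
    convert this using 2 <;> (congr 1; omega)
  · have := congrFun (congrFun h ⟨d - k, by omega⟩) ⟨0, by omega⟩
    simp only [toep] at this
    convert this using 2 <;> (congr 1; omega)

theorem toep_surj (F : Type*) (k : ℕ) (A : Matrix (Fin (k + 1)) (Fin (k + 1)) F)
    (hA : IsToeplitz A) : ∃ t, toep F k t = A := by
  refine ⟨fun d => A ⟨d.val - k, by omega⟩ ⟨k - d.val, by omega⟩, ?_⟩
  funext i j
  unfold toep
  apply hA
  have := i.isLt; have := j.isLt
  simp only
  omega

/-- `t ↦ x T(t)` as a linear map. -/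
def toepMap (F : Type*) [Field F] (k : ℕ) (x : Fin (k + 1) → F) :
    (Fin (2 * k + 1) → F) →ₗ[F] (Fin (k + 1) → F) where
  toFun t := Matrix.vecMul x (toep F k t)
  map_add' s t := by
    rw [← Matrix.vecMul_add]; rfl
  map_smul' c t := by
    simp only [RingHom.id_apply]
    rw [← Matrix.vecMul_smul]; rfl

theorem toepMap_surj (F : Type*) [Field F] (k : ℕ) (x : Fin (k + 1) → F) (hx : x ≠ 0) :
    Function.Surjective (toepMap F k x) := by
  rw [← LinearMap.dualMap_injective_iff, injective_iff_map_eq_zero]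
  intro φ hφ
  let c : Fin (k + 1) → F := fun j => φ (Pi.single j 1)
  have hφc : ∀ y, φ y = ∑ j, y j * c j := by
    intro y
    conv_lhs => rw [pi_eq_sum_univ' y]
    simp [c, map_sum]
  have key : ∀ d, d < 2 * k + 1 →
      ∑ i : Fin (k + 1), ∑ j : Fin (k + 1), (if i.val + k - j.val = d then x i * c j else 0) = 0 := by
    intro d hd
    have h := LinearMap.congr_fun hφ (Pi.single ⟨d, hd⟩ 1)
    rw [LinearMap.dualMap_apply, hφc] at h
    rw [Finset.sum_comm]
    simp only [toepMap, LinearMap.coe_mk, AddHom.coe_mk, Matrix.vecMul, dotProduct, toep,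
      Finset.sum_mul, LinearMap.zero_apply] at h
    refine Eq.trans ?_ h
    refine Finset.sum_congr rfl fun j _ => Finset.sum_congr rfl fun i _ => ?_
    simp only [Pi.single_apply, Fin.mk.injEq]
    split_ifs <;> simp
  let P : Polynomial F := ∑ i : Fin (k + 1), Polynomial.monomial i.val (x i)
  let Q : Polynomial F := ∑ j : Fin (k + 1), Polynomial.monomial (k - j.val) (c j)
  have hPQ : P * Q = 0 := by
    ext d
    simp only [P, Q, Finset.sum_mul_sum, Polynomial.monomial_mul_monomial,
      Polynomial.finsetSum_coeff, Polynomial.coeff_monomial, Polynomial.coeff_zero]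
    by_cases hd : d < 2 * k + 1
    · refine Eq.trans ?_ (key d hd)
      refine Finset.sum_congr rfl fun i _ => Finset.sum_congr rfl fun j _ => ?_
      have := j.isLt
      rw [show i.val + (k - j.val) = i.val + k - j.val by omega]
    · refine Finset.sum_eq_zero fun i _ => Finset.sum_eq_zero fun j _ => ?_
      have := i.isLt
      rw [if_neg (by omega)]
  have hP : P ≠ 0 := by
    intro h0
    apply hx
    funext i
    have := congrArg (fun p => Polynomial.coeff p i.val) h0
    simpa [P, Polynomial.finsetSum_coeff, Polynomial.coeff_monomial, Fin.val_inj] using this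
  have hQ : Q = 0 := (mul_eq_zero.mp hPQ).resolve_left hP
  have hc : ∀ j, c j = 0 := by
    intro j
    have := congrArg (fun p => Polynomial.coeff p (k - j.val)) hQ
    simp only [Q, Polynomial.finsetSum_coeff, Polynomial.coeff_monomial,
      Polynomial.coeff_zero] at this
    rw [Finset.sum_eq_single j] at this
    · simpa using this
    · intro b _ hb
      have := b.isLt
      have := j.isLt
      rw [if_neg]
      intro h
      apply hb
      apply Fin.ext
      omega
    · simp
  refine LinearMap.ext fun y => ?_
  rw [hφc]
  simp [hc]

theorem toepMap_fiber (F : Type*) [Field F] [Fintype F] (k : ℕ) (x : Fin (k + 1) → F)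
    (hx : x ≠ 0) (y : Fin (k + 1) → F) :
    (Finset.univ.filter (fun t => toepMap F k x t = y)).card = Fintype.card F ^ k := by
  have hs := toepMap_surj F k x hx
  have hconst : ∀ z, (Finset.univ.filter (fun t => toepMap F k x t = z)).card =
      (Finset.univ.filter (fun t => toepMap F k x t = y)).card := by
    intro z
    obtain ⟨u, hu⟩ := hs (z - y)
    symm
    refine Finset.card_bij (fun t _ => t + u) ?_ ?_ ?_
    · intro t ht
      simp only [Finset.mem_filter, Finset.mem_univ, true_and] at ht ⊢
      rw [map_add, ht, hu]; abel
    · intro a _ b _ h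
      exact add_right_cancel h
    · intro b hb
      simp only [Finset.mem_filter, Finset.mem_univ, true_and] at hb
      refine ⟨b - u, ?_, by abel⟩
      simp only [Finset.mem_filter, Finset.mem_univ, true_and]
      rw [map_sub, hb, hu]; abel
  have h := Finset.card_eq_sum_card_fiberwise (s := Finset.univ) (t := Finset.univ)
    (f := fun t => toepMap F k x t) (fun _ _ => Finset.mem_coe.2 (Finset.mem_univ _))
  rw [Finset.sum_congr rfl (fun z _ => hconst z)] at h
  simp only [Finset.sum_const, Finset.card_univ, Fintype.card_pi, Finset.prod_const,
    Fintype.card_fin, smul_eq_mul] at h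
  have hq : 0 < Fintype.card F := Fintype.card_pos
  have hp : Fintype.card F ^ (2 * k + 1) = Fintype.card F ^ (k + 1) * Fintype.card F ^ k := by
    rw [← pow_add]; congr 1; omega
  rw [hp] at h
  exact (Nat.eq_of_mul_eq_mul_left (pow_pos hq _) h).symm

theorem wt_eq (ι : Type*) [Fintype ι] (F : Type*) [Zero F] (v : ι → F) :
    wt v = (Finset.univ.filter (fun i => v i ≠ 0)).card := by
  unfold wt
  rw [Nat.card_eq_fintype_card, Fintype.card_subtype]

theorem card_wt (ι : Type*) [Fintype ι] [DecidableEq ι] (F : Type*) [Field F] [Fintype F] (j : ℕ) :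
    (Finset.univ.filter (fun v : ι → F => wt v = j)).card =
      (Fintype.card ι).choose j * (Fintype.card F - 1) ^ j := by
  rw [Finset.card_eq_sum_card_fiberwise (t := Finset.powersetCard j Finset.univ)
    (f := fun v : ι → F => Finset.univ.filter (fun i => v i ≠ 0))]
  · rw [Finset.sum_congr rfl (g := fun _ => (Fintype.card F - 1) ^ j)]
    · simp
    · intro s hs
      have hs' := (Finset.mem_powersetCard.1 hs).2
      have : (Finset.filter (fun v : ι → F => Finset.univ.filter (fun i => v i ≠ 0) = s)
          (Finset.univ.filter (fun v : ι → F => wt v = j))) =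
          Fintype.piFinset (fun i => if i ∈ s then (Finset.univ.erase (0 : F)) else {0}) := by
        ext v
        simp only [Finset.mem_filter, Finset.mem_univ, true_and, Fintype.mem_piFinset]
        constructor
        · rintro ⟨_, h⟩ i
          split_ifs with hi
          · rw [← h] at hi
            simpa using hi
          · rw [← h] at hi
            simpa using hi
        · intro h
          have h2 : Finset.univ.filter (fun i => v i ≠ 0) = s := by
            ext i
            have := h i
            split_ifs at this with hi
            · simpa [hi] using this
            · simpa [hi] using this
          exact ⟨by rw [wt_eq, h2, hs'], h2⟩
      rw [this, Fintype.card_piFinset, ← hs']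
      rw [Finset.prod_congr rfl (g := fun i => if i ∈ s then (Fintype.card F - 1) else 1)]
      · rw [Finset.prod_ite_mem]; simp
      · intro i _
        split_ifs
        · rw [Finset.card_erase_of_mem (Finset.mem_univ _), Finset.card_univ]
        · simp
  · intro v hv
    simp only [Finset.coe_filter, Finset.mem_univ, true_and, Set.mem_ofPred_eq] at hv
    rw [wt_eq] at hv
    simp only [Finset.mem_coe, Finset.mem_powersetCard]
    exact ⟨Finset.subset_univ _, hv⟩

theorem wt_elim_zero (m : ℕ) (F : Type*) [Field F] (y : Fin m → F) :
    wt (Sum.elim (0 : Fin m → F) y) = wt y := by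
  simp only [wt_eq, Finset.card_filter, Fintype.sum_sum_type]
  simp only [Sum.elim_inl, Sum.elim_inr, Pi.zero_apply, ne_eq, not_true_eq_false, if_false,
    Finset.sum_const_zero, zero_add]
  refine Finset.sum_congr rfl fun i _ => ?_
  congr

theorem ncard_code (m : ℕ) (F : Type*) [Field F] [Fintype F] (A : Matrix (Fin m) (Fin m) F)
    (j : ℕ) : {c ∈ DTcode A | wt c = j}.ncard =
      (Finset.univ.filter (fun x : Fin m → F => wt (Sum.elim x (Matrix.vecMul x A)) = j)).card := by
  have : {c ∈ DTcode A | wt c = j} = ((Finset.univ.filter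
      (fun x : Fin m → F => wt (Sum.elim x (Matrix.vecMul x A)) = j)).image
        (fun x => Sum.elim x (Matrix.vecMul x A)) : Set (Fin m ⊕ Fin m → F)) := by
    ext c
    simp only [DTcode, Set.mem_ofPred_eq, Finset.coe_image, Finset.coe_filter, Finset.mem_univ,
      true_and, Set.mem_image]
    constructor
    · rintro ⟨⟨x, rfl⟩, h⟩
      exact ⟨x, h, rfl⟩
    · rintro ⟨x, h, rfl⟩
      exact ⟨⟨x, rfl⟩, h⟩
  rw [this, Set.ncard_coe_finset, Finset.card_image_of_injective]
  intro a b h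
  funext i
  exact congrFun h (Sum.inl i)

theorem sum_toep (F : Type*) [Field F] [Fintype F] (k : ℕ)
    (f : Matrix (Fin (k + 1)) (Fin (k + 1)) F → ℕ) :
    ∑ A ∈ Finset.univ.filter (fun A : Matrix (Fin (k + 1)) (Fin (k + 1)) F => IsToeplitz A), f A =
      ∑ t, f (toep F k t) := by
  symm
  refine Finset.sum_bij (fun t _ => toep F k t) ?_ ?_ ?_ ?_
  · intro t _
    simpa using toep_isToeplitz F k t
  · intro a _ b _ h
    exact toep_inj F k h
  · intro A hA
    obtain ⟨t, ht⟩ := toep_surj F k A (by simpa using hA)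
    exact ⟨t, Finset.mem_univ _, ht⟩
  · intros; rfl

theorem wt_zero_iff (ι : Type*) [Fintype ι] (F : Type*) [Zero F] (v : ι → F) :
    wt v = 0 ↔ v = 0 := by
  rw [wt_eq, Finset.card_eq_zero, Finset.filter_eq_empty_iff]
  simp [funext_iff]

theorem count_pairs (F : Type*) [Field F] [Fintype F] (m j : ℕ) :
    ∑ x : Fin m → F, (Finset.univ.filter (fun y : Fin m → F => wt (Sum.elim x y) = j)).card =
      (2 * m).choose j * (Fintype.card F - 1) ^ j := by
  have h := card_wt (Fin m ⊕ Fin m) F j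
  rw [Fintype.card_sum, Fintype.card_fin, ← two_mul] at h
  rw [← h]
  simp only [Finset.card_filter]
  rw [← Fintype.sum_prod_type' (fun x y : Fin m → F => if wt (Sum.elim x y) = j then 1 else 0)]
  symm
  apply Fintype.sum_equiv (Equiv.sumArrowEquivProdArrow (Fin m) (Fin m) F)
  intro v
  have : Sum.elim (v ∘ Sum.inl) (v ∘ Sum.inr) = v := Sum.elim_comp_inl_inr v
  simp [Equiv.sumArrowEquivProdArrow, this]

theorem fiber_count (F : Type*) [Field F] [Fintype F] (k j : ℕ) (x : Fin (k + 1) → F)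
    (hx : x ≠ 0) :
    (Finset.univ.filter
      (fun t => wt (Sum.elim x (Matrix.vecMul x (toep F k t))) = j)).card =
    Fintype.card F ^ k *
      (Finset.univ.filter (fun y : Fin (k + 1) → F => wt (Sum.elim x y) = j)).card := by
  rw [Finset.card_eq_sum_card_fiberwise
    (t := Finset.univ.filter (fun y : Fin (k + 1) → F => wt (Sum.elim x y) = j))
    (f := fun t => toepMap F k x t)]
  · rw [Finset.sum_congr rfl (g := fun _ => Fintype.card F ^ k)]
    · simp [mul_comm]
    · intro y hy
      rw [← toepMap_fiber F k x hx y, Finset.filter_filter]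
      congr 1
      ext t
      simp only [Finset.mem_filter, Finset.mem_univ, true_and] at hy ⊢
      constructor
      · exact fun h => h.2
      · intro h
        refine ⟨?_, h⟩
        have h' : Matrix.vecMul x (toep F k t) = y := h
        rw [h', hy]
  · intro t ht
    simp only [Finset.coe_filter, Finset.mem_univ, true_and] at ht ⊢
    exact ht

theorem main_count (F : Type*) [Field F] [Fintype F] (k j : ℕ) (hj : 1 ≤ j) :
    (∑ A ∈ Finset.univ.filter (fun A : Matrix (Fin (k + 1)) (Fin (k + 1)) F => IsToeplitz A),
          {c ∈ DTcode A | wt c = j}.ncard) =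
      Fintype.card F ^ k * ((2 * (k + 1)).choose j - (k + 1).choose j) *
        (Fintype.card F - 1) ^ j := by
  rw [sum_toep]
  simp only [ncard_code]
  have hswap : ∑ t : Fin (2 * k + 1) → F, (Finset.univ.filter (fun x : Fin (k + 1) → F =>
      wt (Sum.elim x (Matrix.vecMul x (toep F k t))) = j)).card =
      ∑ x : Fin (k + 1) → F, (Finset.univ.filter (fun t =>
        wt (Sum.elim x (Matrix.vecMul x (toep F k t))) = j)).card := by
    simp only [Finset.card_filter]
    exact Finset.sum_comm
  rw [hswap, ← Finset.add_sum_erase _ _ (Finset.mem_univ (0 : Fin (k + 1) → F))]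
  rw [Finset.sum_congr rfl (fun x hx => fiber_count F k j x (Finset.ne_of_mem_erase hx)),
    ← Finset.mul_sum]
  have h0 : (Finset.univ.filter (fun t => wt (Sum.elim (0 : Fin (k + 1) → F)
      (Matrix.vecMul (0 : Fin (k + 1) → F) (toep F k t))) = j)).card = 0 := by
    rw [Finset.card_eq_zero, Finset.filter_eq_empty_iff]
    intro t _ h
    rw [Matrix.zero_vecMul, wt_elim_zero, (wt_zero_iff _ _ _).2 rfl] at h
    omega
  have h1 := count_pairs F (k + 1) j
  rw [← Finset.add_sum_erase _ _ (Finset.mem_univ (0 : Fin (k + 1) → F))] at h1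
  have e : (Finset.univ.filter (fun y : Fin (k + 1) → F =>
      wt (Sum.elim (0 : Fin (k + 1) → F) y) = j)).card =
      (k + 1).choose j * (Fintype.card F - 1) ^ j := by
    have h2 := card_wt (Fin (k + 1)) F j
    rw [Fintype.card_fin] at h2
    rw [← h2]
    congr 1
    ext y
    simp only [Finset.mem_filter, Finset.mem_univ, wt_elim_zero]
  rw [e] at h1
  rw [h0, zero_add, mul_assoc, Nat.sub_mul, ← h1, Nat.add_sub_cancel_left]

/-- The coefficients of the average weight enumerator of double Toeplitz codes:
summed over all `m × m` Toeplitz matrices `A` over a field with `q` elements,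
the number of codewords of `C(A)` of weight exactly `j` is
`q^(m-1) * (C(2m,j) - C(m,j)) * (q-1)^j` for `1 ≤ j ≤ m`, and
`q^(m-1) * C(2m,j) * (q-1)^j` for `m < j ≤ 2m`; the number of weight-`0`
codewords is `q^(2m-1)`. -/
theorem stmt2 (q : ℕ) (hq : IsPrimePow q) (F : Type*) [Field F] [Fintype F]
    (hF : Fintype.card F = q) (m : ℕ) (hm : 1 ≤ m) :
    (∀ j : ℕ, 1 ≤ j → j ≤ 2 * m →
      (∑ A ∈ Finset.univ.filter (fun A : Matrix (Fin m) (Fin m) F => IsToeplitz A),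
          {c ∈ DTcode A | wt c = j}.ncard) =
        if j ≤ m then
          q ^ (m - 1) * (Nat.choose (2 * m) j - Nat.choose m j) * (q - 1) ^ j
        else q ^ (m - 1) * Nat.choose (2 * m) j * (q - 1) ^ j) ∧
    (∑ A ∈ Finset.univ.filter (fun A : Matrix (Fin m) (Fin m) F => IsToeplitz A),
        {c ∈ DTcode A | wt c = 0}.ncard) = q ^ (2 * m - 1) := by
  subst hF
  obtain ⟨k, rfl⟩ : ∃ k, m = k + 1 := ⟨m - 1, by omega⟩
  constructor
  · intro j hj _
    rw [main_count F k j hj, Nat.add_sub_cancel]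
    split_ifs with h
    · rfl
    · rw [Nat.choose_eq_zero_of_lt (n := k + 1) (by omega), Nat.sub_zero]
  · rw [sum_toep]
    simp only [ncard_code]
    rw [Finset.sum_congr rfl (g := fun _ => 1)]
    · simp only [Finset.sum_const, Finset.card_univ, Fintype.card_pi, Finset.prod_const,
        Fintype.card_fin, smul_eq_mul, mul_one]
      congr 1
    · intro t _
      rw [Finset.card_eq_one]
      refine ⟨0, ?_⟩
      ext x
      simp only [Finset.mem_filter, Finset.mem_univ, true_and, Finset.mem_singleton, wt_zero_iff]
      constructor
      · intro h
        funext i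
        exact congrFun h (Sum.inl i)
      · rintro rfl
        rw [Matrix.zero_vecMul]
        funext i
        cases i <;> rfl
end

section
/- Let q be a prime power, m ≥ 1, n = 2m, and let A be an m×m Toeplitz matrix over F_q. Then the double Toeplitz code C(A) is isodual: C(A) is equivalent to its dual code C(A)^⊥. -/
open Matrix

/-- A square matrix is monomial if each row and each column has exactly one nonzero entry. -/
def IsMonomial {ι : Type*} {F : Type*} [Zero F] (P : Matrix ι ι F) : Prop :=
  (∀ i, ∃! j, P i j ≠ 0) ∧ (∀ j, ∃! i, P i j ≠ 0)

/-- The dual code of a code `C ⊆ F^ι` under the standard inner product. -/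
def dualCode {ι : Type*} [Fintype ι] {F : Type*} [Field F] (C : Set (ι → F)) :
    Set (ι → F) :=
  {y | ∀ x ∈ C, ∑ i, x i * y i = 0}

/-- Every double Toeplitz code is isodual: `C(A)⊥` is obtained from `C(A)`
by a monomial transformation. -/
theorem stmt4 (q : ℕ) (hq : IsPrimePow q) (F : Type*) [Field F] [Fintype F]
    (hF : Fintype.card F = q) (m : ℕ) (hm : 1 ≤ m)
    (A : Matrix (Fin m) (Fin m) F) (hA : IsToeplitz A) :
    ∃ P : Matrix (Fin m ⊕ Fin m) (Fin m ⊕ Fin m) F, IsMonomial P ∧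
      dualCode (DTcode A) = (fun x => Matrix.vecMul x P) '' DTcode A := by
  classical
  have key : ∀ i j : Fin m, A (Fin.rev j) (Fin.rev i) = A i j := by
    intro i j
    apply hA
    simp only [Fin.val_rev]
    omega
  let R : Matrix (Fin m) (Fin m) F := Matrix.of fun i j => if i = Fin.rev j then 1 else 0
  have hR : ∀ i j, R i j = if i = Fin.rev j then 1 else 0 := fun _ _ => rfl
  have hrev : ∀ i j : Fin m, i = Fin.rev j ↔ j = Fin.rev i := by
    intro i j
    constructor <;> (intro h; rw [h, Fin.rev_rev])
  have hvR : ∀ x : Fin m → F, Matrix.vecMul x R = fun j => x (Fin.rev j) := by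
    intro x
    funext j
    simp [Matrix.vecMul, dotProduct, hR]
  refine ⟨Matrix.fromBlocks 0 R (-R) 0, ⟨?_, ?_⟩, ?_⟩
  · rintro (i | i)
    · refine ⟨Sum.inr (Fin.rev i), by simp [hR], ?_⟩
      rintro (j | j) <;> simp [hR, hrev i]
    · refine ⟨Sum.inl (Fin.rev i), by simp [hR], ?_⟩
      rintro (j | j) <;> simp [hR, hrev i]
  · rintro (i | i)
    · refine ⟨Sum.inr (Fin.rev i), by simp [hR], ?_⟩
      rintro (j | j) <;> simp [hR]
    · refine ⟨Sum.inl (Fin.rev i), by simp [hR], ?_⟩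
      rintro (j | j) <;> simp [hR]
  · have himg : ∀ x : Fin m → F,
        Matrix.vecMul (Sum.elim x (Matrix.vecMul x A)) (Matrix.fromBlocks 0 R (-R) 0) =
        Sum.elim (fun i => -∑ j, A i j * x (Fin.rev j)) (fun j => x (Fin.rev j)) := by
      intro x
      rw [Matrix.vecMul_fromBlocks]
      have h1 : (Sum.elim x (Matrix.vecMul x A)) ∘ Sum.inl = x := rfl
      have h2 : (Sum.elim x (Matrix.vecMul x A)) ∘ Sum.inr = Matrix.vecMul x A := rfl
      rw [h1, h2, Matrix.vecMul_neg, hvR, hvR, Matrix.vecMul_zero, Matrix.vecMul_zero,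
        zero_add, add_zero]
      congr 1
      funext i
      simp only [Pi.neg_apply, Matrix.vecMul, dotProduct]
      congr 1
      rw [← Equiv.sum_comp Fin.revPerm]
      refine Finset.sum_congr rfl fun j _ => ?_
      rw [Fin.revPerm_apply, key, mul_comm]
    ext y
    constructor
    · intro hy
      refine ⟨_, ⟨fun j => y (Sum.inr (Fin.rev j)), rfl⟩, ?_⟩
      show Matrix.vecMul _ _ = y
      rw [himg]
      funext k
      rcases k with i | j
      · have h := hy _ ⟨Pi.single i 1, rfl⟩
        simp [Fintype.sum_sum_type, Pi.single_apply, Matrix.single_one_vecMul] at h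
        simp only [Sum.elim_inl, Fin.rev_rev]
        exact (eq_neg_of_add_eq_zero_left h).symm
      · simp
    · rintro ⟨_, ⟨x, rfl⟩, rfl⟩
      show Matrix.vecMul _ _ ∈ _
      rw [himg]
      rintro _ ⟨z, rfl⟩
      simp only [Fintype.sum_sum_type, Sum.elim_inl, Sum.elim_inr, Matrix.vecMul, dotProduct,
        mul_neg, Finset.sum_neg_distrib, Finset.mul_sum, Finset.sum_mul]
      rw [Finset.sum_comm, neg_add_eq_zero]
      refine Finset.sum_congr rfl fun j _ => Finset.sum_congr rfl fun i _ => ?_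
      ring
end

section
/- Let q be a prime power, m ≥ 1, and let A be an m×m Toeplitz matrix over F_q. Then the transpose Aᵀ is again a Toeplitz matrix and the double Toeplitz codes C(A) and C(Aᵀ) are equivalent. -/
open Matrix

/-- For a Toeplitz matrix `A`, the transpose `Aᵀ` is again Toeplitz and the
codes `C(A)` and `C(Aᵀ)` are equivalent. -/
theorem stmt6 (q : ℕ) (hq : IsPrimePow q) (F : Type*) [Field F] [Fintype F]
    (hF : Fintype.card F = q) (m : ℕ) (hm : 1 ≤ m)
    (A : Matrix (Fin m) (Fin m) F) (hA : IsToeplitz A) :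
    IsToeplitz Aᵀ ∧
    ∃ P : Matrix (Fin m ⊕ Fin m) (Fin m ⊕ Fin m) F, IsMonomial P ∧
      DTcode Aᵀ = (fun x => Matrix.vecMul x P) '' DTcode A := by
  have hrev : ∀ i j : Fin m, A (Fin.rev i) (Fin.rev j) = A j i := by
    intro i j
    apply hA
    simp only [Fin.val_rev]
    omega
  refine ⟨fun i j i' j' h => hA _ _ _ _ (by omega), ?_⟩
  let σ : Fin m ⊕ Fin m → Fin m ⊕ Fin m := Sum.map Fin.rev Fin.rev
  have hσ : ∀ i, σ (σ i) = i := by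
    rintro (i | i) <;> simp [σ]
  let P : Matrix (Fin m ⊕ Fin m) (Fin m ⊕ Fin m) F :=
    fun i j => if i = σ j then 1 else 0
  have hP : ∀ c : Fin m ⊕ Fin m → F, Matrix.vecMul c P = fun j => c (σ j) := by
    intro c
    funext j
    simp [Matrix.vecMul, dotProduct, P]
  have key : ∀ x : Fin m → F, Matrix.vecMul (Sum.elim x (Matrix.vecMul x A)) P =
      Sum.elim (fun i => x (Fin.rev i)) (Matrix.vecMul (fun i => x (Fin.rev i)) Aᵀ) := by
    intro x
    rw [hP]
    funext j
    rcases j with j | j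
    · simp [σ]
    · simp only [σ, Sum.map_inr, Sum.elim_inr, Matrix.vecMul, dotProduct, Matrix.transpose_apply]
      rw [← Equiv.sum_comp Fin.revPerm]
      refine Finset.sum_congr rfl fun i _ => ?_
      simp [hrev]
  refine ⟨P, ⟨fun i => ⟨σ i, ?_, ?_⟩, fun j => ⟨σ j, ?_, ?_⟩⟩, ?_⟩
  · simp [P, hσ]
  · intro j hj
    have h : i = σ j := by
      by_contra h
      exact hj (by simp [P, h])
    rw [h, hσ]
  · simp [P]
  · intro i hi
    by_contra h
    exact hi (by simp [P, h])
  · ext c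
    constructor
    · rintro ⟨x, rfl⟩
      refine ⟨_, ⟨fun i => x (Fin.rev i), rfl⟩, ?_⟩
      simp only [key, Fin.rev_rev]
    · rintro ⟨_, ⟨x, rfl⟩, rfl⟩
      exact ⟨_, key x⟩
end

section
/- Let m ≥ 1 and let A be an m×m Toeplitz matrix over F_2 with first row (t, a_1, …, a_{m−1}) and first column (t, b_1, …, b_{m−1})ᵀ. Then there exists an m×m Toeplitz matrix A' over F_2, with first row (t', a'_1, …, a'_{m−1}) and first column (t', b'_1, …, b'_{m−1})ᵀ, such that the double Toeplitz codes C(A) and C(A') are equivalent and Σ_{i=1}^{m−1} 2^{i−1}·g(a'_i) ≥ Σ_{i=1}^{m−1} 2^{i−1}·g(b'_i), where g : F_2 → ℤ is given by g(0) = 0 and g(1) = 1. -/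
open Matrix

/-- The monomial matrix of an equivalence. -/
def permMat {ι : Type*} [DecidableEq ι] (σ : ι ≃ ι) : Matrix ι ι (ZMod 2) :=
  fun a b => if a = σ b then 1 else 0

theorem permMat_mono {ι : Type*} [DecidableEq ι] (σ : ι ≃ ι) : IsMonomial (permMat σ) := by
  constructor
  · intro i
    refine ⟨σ.symm i, by simp [permMat], ?_⟩
    intro y hy
    by_contra hne
    apply hy
    have : i ≠ σ y := fun h => hne (by simp [h])
    simp [permMat, this]
  · intro j
    refine ⟨σ j, by simp [permMat], ?_⟩
    intro y hy
    by_contra hne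
    apply hy
    simp [permMat, hne]

theorem vecMul_permMat {ι : Type*} [Fintype ι] [DecidableEq ι] (σ : ι ≃ ι) (x : ι → ZMod 2) :
    Matrix.vecMul x (permMat σ) = x ∘ σ := by
  ext j
  simp [Matrix.vecMul, dotProduct, permMat]

theorem toeplitz_rev {m : ℕ} {A : Matrix (Fin m) (Fin m) (ZMod 2)} (hA : IsToeplitz A)
    (i j : Fin m) : A i.rev j.rev = A j i := by
  apply hA
  simp only [Fin.val_rev]
  omega

theorem vecMul_rev {m : ℕ} {A : Matrix (Fin m) (Fin m) (ZMod 2)} (hA : IsToeplitz A)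
    (x : Fin m → ZMod 2) (j : Fin m) :
    Matrix.vecMul x A j.rev = Matrix.vecMul (x ∘ Fin.rev) Aᵀ j := by
  simp only [Matrix.vecMul, dotProduct, Matrix.transpose_apply, Function.comp]
  rw [← Equiv.sum_comp Fin.revPerm]
  simp [toeplitz_rev hA]

theorem code_transpose {m : ℕ} {A : Matrix (Fin m) (Fin m) (ZMod 2)} (hA : IsToeplitz A) :
    DTcode Aᵀ = (fun x => Matrix.vecMul x
      (permMat (Equiv.sumCongr (Fin.revPerm (n := m)) (Fin.revPerm (n := m))))) '' DTcode A := by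
  have key : ∀ x : Fin m → ZMod 2, Matrix.vecMul (Sum.elim x (Matrix.vecMul x A))
      (permMat (Equiv.sumCongr (Fin.revPerm (n := m)) (Fin.revPerm (n := m)))) =
      Sum.elim (x ∘ Fin.rev) (Matrix.vecMul (x ∘ Fin.rev) Aᵀ) := by
    intro x
    rw [vecMul_permMat]
    ext j
    rcases j with j | j
    · simp
    · simp [vecMul_rev hA]
  ext c
  constructor
  · rintro ⟨x, rfl⟩
    refine ⟨_, ⟨x ∘ Fin.rev, rfl⟩, ?_⟩
    have hx : (x ∘ Fin.rev) ∘ Fin.rev = x := by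
      ext j
      simp
    simp only [key, hx]
  · rintro ⟨_, ⟨x, rfl⟩, rfl⟩
    exact ⟨x ∘ Fin.rev, key x⟩

/-- Every binary double Toeplitz code is equivalent to one `C(A')` where the
binary value of the first row of `A'` (off-diagonal part, read via
`g : F_2 → ℤ`, `g 0 = 0`, `g 1 = 1`) is at least that of its first column. -/
theorem stmt8 (m : ℕ) (hm : 0 < m) (A : Matrix (Fin m) (Fin m) (ZMod 2))
    (hA : IsToeplitz A) :
    ∃ A' : Matrix (Fin m) (Fin m) (ZMod 2), IsToeplitz A' ∧
      (∃ P : Matrix (Fin m ⊕ Fin m) (Fin m ⊕ Fin m) (ZMod 2), IsMonomial P ∧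
        DTcode A' = (fun x => Matrix.vecMul x P) '' DTcode A) ∧
      (∑ i : Fin m, if (i : ℕ) = 0 then (0 : ℤ)
          else 2 ^ ((i : ℕ) - 1) * (if A' ⟨0, hm⟩ i = 1 then 1 else 0)) ≥
      (∑ i : Fin m, if (i : ℕ) = 0 then (0 : ℤ)
          else 2 ^ ((i : ℕ) - 1) * (if A' i ⟨0, hm⟩ = 1 then 1 else 0)) := by
  rcases le_total
      (∑ i : Fin m, if (i : ℕ) = 0 then (0 : ℤ)
          else 2 ^ ((i : ℕ) - 1) * (if A i ⟨0, hm⟩ = 1 then 1 else 0))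
      (∑ i : Fin m, if (i : ℕ) = 0 then (0 : ℤ)
          else 2 ^ ((i : ℕ) - 1) * (if A ⟨0, hm⟩ i = 1 then 1 else 0)) with h | h
  · refine ⟨A, hA, ⟨permMat (Equiv.refl _), permMat_mono _, ?_⟩, h⟩
    simp [vecMul_permMat]
  · refine ⟨Aᵀ, ?_, ⟨_, permMat_mono _, code_transpose hA⟩, h⟩
    intro i j i' j' hij
    exact hA _ _ _ _ (by omega)
end

section
/- Let n = 2m be a positive even integer. There exists an m×m Toeplitz matrix A over F_2 such that the double Toeplitz code C(A) has minimum weight at least 8 if and only if n = 24 or n ≥ 28. -/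
open Matrix

namespace DT

/-- Bit `j` of `n` as an element of `ZMod 2`. -/
def bt (n j : ℕ) : ZMod 2 := if n.testBit j then 1 else 0

lemma bt_ne (n j : ℕ) : bt n j ≠ 0 ↔ n.testBit j = true := by
  unfold bt; split_ifs with h <;> simp [h]

lemma bt_xor (a b j : ℕ) : bt (Nat.xor a b) j = bt a j + bt b j := by
  unfold bt
  have : (Nat.xor a b).testBit j = (a.testBit j ^^ b.testBit j) := Nat.testBit_xor a b j
  rw [this]
  cases a.testBit j <;> cases b.testBit j <;> simp; decide

/-- Fast population count of a 14-bit number. -/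
def pc14 (v : ℕ) : ℕ :=
  Nat.mod (Nat.land (Nat.mul v 35185445863425) 76861433640456465) 15

/-- Fast population count of a 28-bit number. -/
def pc (v : ℕ) : ℕ := Nat.add (pc14 (Nat.mod v 16384)) (pc14 (Nat.div v 16384))

/-- Slow population count. -/
def slow : ℕ → ℕ → ℕ
  | 0, _ => 0
  | k + 1, v => Nat.add (Nat.mod v 2) (slow k (Nat.div v 2))

/-- `p` holds on the whole binary tree below `v`. -/
def allB : ℕ → ℕ → Bool
  | 0, v => Nat.beq (pc14 v) (slow 14 v)
  | k + 1, v => allB k (Nat.mul 2 v) && allB k (Nat.add (Nat.mul 2 v) 1)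

lemma allB_spec : ∀ k v, allB k v = true → ∀ n, n / 2 ^ k = v → pc14 n = slow 14 n
  | 0, v, h, n, hn => by
      simp at hn; subst hn; exact Nat.eq_of_beq_eq_true h
  | k + 1, v, h, n, hn => by
      simp only [allB, Bool.and_eq_true] at h
      have h2 : n / 2 ^ k / 2 = v := by rw [Nat.div_div_eq_div_mul, ← pow_succ]; exact hn
      rcases Nat.mod_two_eq_zero_or_one (n / 2 ^ k) with h3 | h3
      · exact allB_spec k _ h.1 n (by show _ = 2 * v; omega)
      · exact allB_spec k _ h.2 n (by show _ = 2 * v + 1; omega)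

set_option maxRecDepth 100000 in
lemma allB_true : allB 14 0 = true := by decide +kernel

lemma slow_spec : ∀ k v, slow k v = ((Finset.range k).filter (fun j => v.testBit j = true)).card
  | 0, v => by simp [slow]
  | k + 1, v => by
      have h := slow_spec k (v / 2)
      show v % 2 + slow k (v / 2) = _
      rw [h, Finset.card_filter, Finset.card_filter, Finset.sum_range_succ']
      simp only [Nat.testBit_succ]
      rw [add_comm]
      congr 1
      rw [Nat.testBit_zero]
      rcases Nat.mod_two_eq_zero_or_one v with h3 | h3 <;> simp [h3]

lemma pc14_spec (v : ℕ) (h : v < 2 ^ 14) :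
    pc14 v = ((Finset.range 14).filter (fun j => v.testBit j = true)).card := by
  rw [allB_spec 14 0 allB_true v (Nat.div_eq_of_lt h), slow_spec]

lemma card_split (v a b : ℕ) :
    ((Finset.range (a + b)).filter (fun j => v.testBit j = true)).card
    = ((Finset.range a).filter (fun j => (v % 2 ^ a).testBit j = true)).card
      + ((Finset.range b).filter (fun j => (v / 2 ^ a).testBit j = true)).card := by
  rw [Finset.card_filter, Finset.card_filter, Finset.card_filter, Finset.sum_range_add]
  congr 1
  · apply Finset.sum_congr rfl
    intro j hj
    rw [Nat.testBit_mod_two_pow]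
    simp [Finset.mem_range.1 hj]
  · apply Finset.sum_congr rfl
    intro j hj
    rw [Nat.testBit_div_two_pow, add_comm]

lemma pc_eq (v : ℕ) : pc v = pc14 (v % 16384) + pc14 (v / 16384) := by
  unfold pc
  generalize pc14 = f
  rfl

lemma pc_spec28 (v : ℕ) (hv : v < 2 ^ (14 + 14)) :
    pc v = ((Finset.range (14 + 14)).filter (fun j => v.testBit j = true)).card := by
  have h1 : v % 2 ^ 14 < 2 ^ 14 := Nat.mod_lt _ (by positivity)
  have h2 : v / 2 ^ 14 < 2 ^ 14 := Nat.div_lt_of_lt_mul (by rw [← pow_add]; exact hv)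
  rw [card_split, ← pc14_spec _ h1, ← pc14_spec _ h2, pc_eq,
    show (2 : ℕ) ^ 14 = 16384 by norm_num]

lemma pc_spec (m v : ℕ) (hm : m ≤ 28) (h : v < 2 ^ m) :
    pc v = ((Finset.range m).filter (fun j => bt v j ≠ 0)).card := by
  have e1 : (Finset.range m).filter (fun j => bt v j ≠ 0)
      = (Finset.range (14 + 14)).filter (fun j => v.testBit j = true) := by
    ext j
    simp only [Finset.mem_filter, Finset.mem_range, bt_ne]
    constructor
    · rintro ⟨a, b⟩; exact ⟨by omega, b⟩
    · rintro ⟨a, b⟩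
      refine ⟨?_, b⟩
      by_contra hc
      have : v < 2 ^ j := lt_of_lt_of_le h (Nat.pow_le_pow_right (by norm_num) (by omega))
      rw [Nat.testBit_lt_two_pow this] at b
      cases b
  rw [e1]
  exact pc_spec28 v (lt_of_lt_of_le h (Nat.pow_le_pow_right (by norm_num) hm))

/-- Row `k` (counted from the bottom) of the Toeplitz matrix with diagonals `t`. -/
def row (M t k : ℕ) : ℕ := Nat.mod (Nat.shiftRight t k) M

lemma row_lt (m t k : ℕ) : row (2 ^ m) t k < 2 ^ m := Nat.mod_lt _ (by positivity)

lemma bt_row (m t k j : ℕ) (hj : j < m) : bt (row (2 ^ m) t k) j = bt t (j + k) := by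
  have : (row (2 ^ m) t k).testBit j = t.testBit (j + k) := by
    show ((t >>> k) % 2 ^ m).testBit j = _
    rw [Nat.testBit_mod_two_pow, Nat.testBit_shiftRight, add_comm]
    simp [hj]
  unfold bt; rw [this]

/-- Check all combinations of at most `d` of the rows below `k`, added to `acc`. -/
def ok (M t : ℕ) : ℕ → ℕ → ℕ → ℕ → Bool
  | 0, _, acc, w => Nat.beq w 0 || Nat.ble 8 (Nat.add w (pc acc))
  | _ + 1, 0, acc, w => Nat.beq w 0 || Nat.ble 8 (Nat.add w (pc acc))
  | k + 1, d + 1, acc, w =>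
      ok M t k (d + 1) acc w && ok M t k d (Nat.xor acc (row M t k)) (Nat.succ w)

/-- Weight of the `y`-part. -/
def yw (m t acc : ℕ) (S : Finset ℕ) : ℕ :=
  ((Finset.range m).filter (fun j => bt acc j + ∑ k ∈ S, bt t (j + k) ≠ 0)).card

lemma yw_insert (m t acc k : ℕ) (S : Finset ℕ) (hk : k ∉ S) :
    yw m t (Nat.xor acc (row (2 ^ m) t k)) S = yw m t acc (insert k S) := by
  unfold yw
  congr 1
  apply Finset.filter_congr
  intro j hj
  rw [bt_xor, bt_row _ _ _ _ (Finset.mem_range.1 hj), Finset.sum_insert hk, add_assoc]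

lemma xor_lt (m a b : ℕ) (ha : a < 2 ^ m) (hb : b < 2 ^ m) : Nat.xor a b < 2 ^ m :=
  Nat.xor_lt_two_pow ha hb

lemma ok_zero (m t d acc w : ℕ) (hm : m ≤ 28) (hacc : acc < 2 ^ m) :
    ok (2 ^ m) t 0 d acc w = true ↔ (w = 0 ∨ 8 ≤ w + yw m t acc ∅) := by
  have : yw m t acc ∅ = pc acc := by
    rw [pc_spec m acc hm hacc]; unfold yw; simp
  rw [this]
  have : ok (2 ^ m) t 0 d acc w = (Nat.beq w 0 || Nat.ble 8 (Nat.add w (pc acc))) := by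
    cases d <;> rfl
  rw [this, Bool.or_eq_true, Nat.ble_eq]
  constructor
  · rintro (h | h)
    · exact Or.inl (Nat.eq_of_beq_eq_true h)
    · exact Or.inr h
  · rintro (h | h)
    · subst h; exact Or.inl rfl
    · exact Or.inr h

lemma ok_spec (m t : ℕ) (hm : m ≤ 28) : ∀ k d acc w, acc < 2 ^ m →
    (ok (2 ^ m) t k d acc w = true ↔ ∀ S ⊆ Finset.range k, S.card ≤ d →
      (w + S.card = 0 ∨ 8 ≤ w + S.card + yw m t acc S))
  | 0, d, acc, w, h => by
      rw [ok_zero m t d acc w hm h]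
      constructor
      · intro h S hS hc
        have : S = ∅ := by simpa using hS
        subst this; simpa using h
      · intro h; simpa using h ∅ (by simp) (by simp)
  | k + 1, 0, acc, w, h => by
      rw [show ok (2 ^ m) t (k + 1) 0 acc w = ok (2 ^ m) t 0 0 acc w by simp [ok],
        ok_zero m t 0 acc w hm h]
      constructor
      · intro h S hS hc
        have : S = ∅ := by simpa using hc
        subst this; simpa using h
      · intro h; simpa using h ∅ (by simp) (by simp)
  | k + 1, d + 1, acc, w, h => by
      rw [ok, Bool.and_eq_true, ok_spec m t hm k (d + 1) acc w h,
        ok_spec m t hm k d _ _ (xor_lt m _ _ h (row_lt m t k))]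
      constructor
      · rintro ⟨h1, h2⟩ S hS hc
        by_cases hk : k ∈ S
        · have hs : S.erase k ⊆ Finset.range k := by
            intro a ha
            have h3 := Finset.mem_erase.1 ha
            have := Finset.mem_range.1 (hS h3.2)
            exact Finset.mem_range.2 (by omega)
          have hcard := Finset.card_erase_add_one hk
          have := h2 (S.erase k) hs (by omega)
          rw [yw_insert _ _ _ _ _ (Finset.notMem_erase k S), Finset.insert_erase hk] at this
          simp only [Nat.succ_eq_add_one] at this
          omega
        · apply h1 S _ hc
          intro a ha
          have := Finset.mem_range.1 (hS ha)
          have : a ≠ k := fun e => hk (e ▸ ha)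
          exact Finset.mem_range.2 (by omega)
      · intro H
        refine ⟨fun S hS hc => H S (hS.trans (Finset.range_mono (by omega))) hc, ?_⟩
        intro S hS hc
        have hk : k ∉ S := fun hh => by simpa using hS hh
        have h3 := H (insert k S) (by
          intro a ha
          rcases Finset.mem_insert.1 ha with rfl | ha
          · simp
          · have := Finset.mem_range.1 (hS ha)
            exact Finset.mem_range.2 (by omega)) (by
          rw [Finset.card_insert_of_notMem hk]; omega)
        rw [yw_insert _ _ _ _ _ hk]
        rw [Finset.card_insert_of_notMem hk] at h3
        simp only [Nat.succ_eq_add_one]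
        omega

/-! ### Bridge to matrices -/

/-- Toeplitz matrix with diagonals `f`. -/
def T (m : ℕ) (f : ℕ → ZMod 2) : Matrix (Fin m) (Fin m) (ZMod 2) :=
  fun i j => f (j + (m - 1 - i))

lemma T_toeplitz (m : ℕ) (f) : IsToeplitz (T m f) := by
  intro i j i' j' h
  unfold T
  congr 1
  omega

/-- Reversed support. -/
def supp {m : ℕ} (x : Fin m → ZMod 2) : Finset ℕ :=
  (Finset.univ.filter (fun i => x i ≠ 0)).image (fun i : Fin m => m - 1 - i)

lemma zmod2 (a : ZMod 2) : a ≠ 0 → a = 1 := by revert a; decide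

lemma rev_inj {m : ℕ} (s : Finset (Fin m)) :
    Set.InjOn (fun i : Fin m => m - 1 - (i : ℕ)) s := by
  intro a _ b _ h
  simp only at h
  apply Fin.ext; omega

lemma supp_card {m : ℕ} (x : Fin m → ZMod 2) :
    (supp x).card = (Finset.univ.filter (fun i => x i ≠ 0)).card :=
  Finset.card_image_of_injOn (rev_inj _)

lemma supp_sub {m : ℕ} (x : Fin m → ZMod 2) : supp x ⊆ Finset.range m := by
  intro a ha
  obtain ⟨i, -, rfl⟩ := Finset.mem_image.1 ha
  exact Finset.mem_range.2 (by omega)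

lemma vecMul_T {m : ℕ} (f) (x : Fin m → ZMod 2) (j : Fin m) :
    Matrix.vecMul x (T m f) j = ∑ k ∈ supp x, f (j + k) := by
  unfold supp
  rw [Finset.sum_image (rev_inj _), Finset.sum_filter]
  unfold Matrix.vecMul dotProduct
  apply Finset.sum_congr rfl
  intro i _
  split_ifs with h
  · rw [zmod2 _ h, one_mul]; rfl
  · rw [not_not.1 h, zero_mul]

lemma wt_eq {m : ℕ} (x y : Fin m → ZMod 2) : wt (Sum.elim x y) =
    (Finset.univ.filter (fun i => x i ≠ 0)).card + (Finset.univ.filter (fun i => y i ≠ 0)).card := by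
  unfold wt
  rw [Nat.card_eq_fintype_card, Fintype.card_subtype, Finset.card_filter, Finset.card_filter,
    Finset.card_filter, Fintype.sum_sum_type]
  simp only [Sum.elim_inl, Sum.elim_inr]
  congr 1

lemma yw_eq {m : ℕ} (t : ℕ) (x : Fin m → ZMod 2) :
    (Finset.univ.filter (fun j => Matrix.vecMul x (T m (bt t)) j ≠ 0)).card
      = yw m t 0 (supp x) := by
  unfold yw
  rw [Finset.card_filter, Finset.card_filter, Finset.sum_range]
  apply Finset.sum_congr rfl
  intro j _
  rw [vecMul_T]
  simp [bt]

lemma exists_supp (m : ℕ) (S : Finset ℕ) (hS : S ⊆ Finset.range m) :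
    ∃ x : Fin m → ZMod 2, supp x = S := by
  refine ⟨fun i => if m - 1 - (i : ℕ) ∈ S then 1 else 0, ?_⟩
  ext a
  unfold supp
  simp only [Finset.mem_image, Finset.mem_filter, Finset.mem_univ, true_and]
  constructor
  · rintro ⟨i, hi, rfl⟩
    by_contra hc
    simp [hc] at hi
  · intro ha
    have := Finset.mem_range.1 (hS ha)
    have e : m - 1 - (m - 1 - a) = a := by omega
    refine ⟨⟨m - 1 - a, by omega⟩, ?_, ?_⟩
    · simp only [e]; simp [ha]
    · exact e

lemma supp_eq_empty {m : ℕ} (x : Fin m → ZMod 2) : supp x = ∅ ↔ x = 0 := by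
  unfold supp
  rw [Finset.image_eq_empty, Finset.filter_eq_empty_iff]
  constructor
  · intro h; funext i; exact not_not.1 (h (Finset.mem_univ i))
  · rintro rfl i _; simp

/-- The min weight property. -/
def Good (m : ℕ) : Prop := ∃ A : Matrix (Fin m) (Fin m) (ZMod 2), IsToeplitz A ∧
        ∀ c ∈ DTcode A, c ≠ 0 → 8 ≤ wt c

/-- Combinatorial version of the property. -/
def GoodT (m t : ℕ) : Prop := ∀ S ⊆ Finset.range m, S ≠ ∅ → 8 ≤ S.card + yw m t 0 S

lemma goodT_of (m : ℕ) (hm : 1 ≤ m) (h : Good m) : ∃ t, GoodT m t := by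
  obtain ⟨A, hA, hc⟩ := h
  obtain ⟨t, ht⟩ : ∃ t, A = T m (bt t) := by
    let g : Fin (2 * m - 1) → Bool := fun p =>
      if h : (p : ℕ) ≤ m - 1 then decide (A ⟨m - 1 - p, by omega⟩ ⟨0, by omega⟩ ≠ 0)
      else decide (A ⟨0, by omega⟩ ⟨p - (m - 1), by omega⟩ ≠ 0)
    refine ⟨Nat.ofBits g, ?_⟩
    ext i j
    unfold T bt
    rw [Nat.testBit_ofBits_lt _ _ (show (j : ℕ) + (m - 1 - i) < 2 * m - 1 by omega)]
    simp only [g]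
    split_ifs with h1 h2 h2
    all_goals simp only [decide_eq_true_eq, not_not] at h2
    · rw [← zmod2 _ h2]; apply hA; simp; omega
    · rw [← h2]; apply hA; simp; omega
    · rw [← zmod2 _ h2]; apply hA; simp; omega
    · rw [← h2]; apply hA; simp; omega
  refine ⟨t, fun S hS hne => ?_⟩
  obtain ⟨x, rfl⟩ := exists_supp m S hS
  have h0 : x ≠ 0 := fun e => hne ((supp_eq_empty x).2 e)
  have := hc _ ⟨x, rfl⟩ (fun e => h0 (by
    funext i; simpa using congrFun e (Sum.inl i)))
  rw [wt_eq, ← supp_card, ht, yw_eq] at this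
  exact this

/-! ### Explicit codes -/

/-- `⊕_{k < n, bit (m-1-k) ...}`: the combination of the rows of `T s` with coefficients `r`. -/
def mulRow (M s m1 r : ℕ) : ℕ → ℕ
  | 0 => 0
  | k + 1 => Nat.xor (mulRow M s m1 r k)
      (cond (Nat.testBit r k) (row M s (Nat.sub m1 k)) 0)

/-- Check that `T t * T s = 1`. -/
def invOK (M m1 t s : ℕ) : ℕ → Bool
  | 0 => true
  | i + 1 => invOK M m1 t s i &&
      Nat.beq (mulRow M s m1 (row M t (Nat.sub m1 i)) (Nat.succ m1)) (Nat.pow 2 i)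

lemma bt_zero (j : ℕ) : bt 0 j = 0 := by simp [bt]

lemma mulRow_spec (m s m1 r : ℕ) (j : ℕ) (hj : j < m) : ∀ k,
    bt (mulRow (2 ^ m) s m1 r k) j = ∑ i ∈ Finset.range k, bt r i * bt s (j + (m1 - i))
  | 0 => by simp [mulRow, bt_zero]
  | k + 1 => by
      rw [mulRow, bt_xor, mulRow_spec m s m1 r j hj k, Finset.sum_range_succ]
      congr 1
      by_cases h : r.testBit k = true
      · rw [h]; simp only [cond_true]
        rw [bt_row _ _ _ _ hj]; simp [bt, h]
      · simp [bt, h]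

lemma invOK_spec (M m1 t s : ℕ) : ∀ n, invOK M m1 t s n = true → ∀ i < n,
    mulRow M s m1 (row M t (m1 - i)) (m1 + 1) = 2 ^ i
  | 0, _, i, hi => by omega
  | n + 1, h, i, hi => by
      rw [invOK, Bool.and_eq_true] at h
      by_cases e : i = n
      · subst e; exact Nat.eq_of_beq_eq_true h.2
      · exact invOK_spec M m1 t s n h.1 i (by omega)

lemma inv_mat (m t s : ℕ) (hm : 1 ≤ m) (h : invOK (2 ^ m) (m - 1) t s m = true) :
    T m (bt t) * T m (bt s) = 1 := by
  ext i j
  have h1 := invOK_spec _ _ _ _ _ h i i.2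
  have h2 := mulRow_spec m s (m - 1) (row (2 ^ m) t (m - 1 - i)) j j.2 (m - 1 + 1)
  rw [h1, Nat.sub_add_cancel hm, Finset.sum_range] at h2
  rw [Matrix.mul_apply]
  have h3 : ∑ k, T m (bt t) i k * T m (bt s) k j = bt (2 ^ (i : ℕ)) j := by
    rw [h2]
    apply Finset.sum_congr rfl
    intro k _
    rw [bt_row _ _ _ _ k.2]; rfl
  rw [h3, Matrix.one_apply]
  unfold bt
  rw [Nat.testBit_two_pow]
  simp [Fin.ext_iff]

/-- The doubled circulant sequence. -/
def dbl (M a : ℕ) : ℕ := Nat.div (Nat.mul a (Nat.succ M)) 2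

/-- Whole check for an explicit circulant pair. -/
def full (m M a b : ℕ) : Bool :=
  invOK M (Nat.pred m) (dbl M a) (dbl M b) m &&
    (ok M (dbl M a) m 3 0 0 && ok M (dbl M b) m 3 0 0)

lemma good_full (m M a b : ℕ) (hm : 1 ≤ m) (hm2 : m ≤ 28) (hM : M = 2 ^ m)
    (h : full m M a b = true) : Good m := by
  subst hM
  unfold full at h
  generalize dbl (2 ^ m) a = t at h
  generalize dbl (2 ^ m) b = s at h
  rw [Bool.and_eq_true, Bool.and_eq_true] at h
  obtain ⟨hi, ht, hs⟩ := h
  have hI := inv_mat m t s hm hi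
  rw [ok_spec m _ hm2 _ _ _ _ (by positivity)] at ht hs
  refine ⟨T m (bt t), T_toeplitz _ _, ?_⟩
  rintro c ⟨x, rfl⟩ hc
  have hx : x ≠ 0 := by
    rintro rfl
    apply hc
    funext i
    rcases i with i | i <;> simp
  rw [wt_eq]
  by_contra hlt
  set y := Matrix.vecMul x (T m (bt t)) with hy
  have hxy : Matrix.vecMul y (T m (bt s)) = x := by
    rw [hy, Matrix.vecMul_vecMul, hI, Matrix.vecMul_one]
  have hy0 : y ≠ 0 := by
    intro e; apply hx; rw [← hxy, e, Matrix.zero_vecMul]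
  have a1 := yw_eq t x
  have a2 := yw_eq s y
  rw [← hy] at a1
  rw [hxy] at a2
  have b1 := supp_card x
  have b2 := supp_card y
  have c1 : (supp x).card ≠ 0 := by
    rw [Ne, Finset.card_eq_zero, supp_eq_empty]; exact hx
  have c2 : (supp y).card ≠ 0 := by
    rw [Ne, Finset.card_eq_zero, supp_eq_empty]; exact hy0
  by_cases h3 : (supp x).card ≤ 3
  · have := ht _ (supp_sub x) h3
    omega
  · have := hs _ (supp_sub y) (by omega)
    omega

/-! ### Nonexistence by search -/

/-- Depth first search; `true` means that no good sequence extends `t` (with `n` known bits). -/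
def go (M m : ℕ) : ℕ → ℕ → ℕ → Bool
  | 0, n, t => not (ok M t (Nat.sub n m) 2 (row M t (Nat.sub n m)) 1)
  | f + 1, n, t =>
      cond (Nat.ble m n && not (ok M t (Nat.sub n m) 2 (row M t (Nat.sub n m)) 1)) true
        (go M m f (Nat.succ n) t && go M m f (Nat.succ n) (Nat.add t (Nat.pow 2 n)))

lemma bt_congr (t t' n j : ℕ) (h : t' % 2 ^ n = t % 2 ^ n) (hj : j < n) : bt t' j = bt t j := by
  have h1 := Nat.testBit_mod_two_pow t n j
  have h2 := Nat.testBit_mod_two_pow t' n j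
  rw [h] at h2
  unfold bt
  simp only [hj, decide_true, Bool.true_and] at h1 h2
  rw [← h1, ← h2]

lemma not_good_of_ok (m t t' r : ℕ) (hm : m ≤ 28) (hr : r < m)
    (h : t' % 2 ^ (m + r) = t % 2 ^ (m + r))
    (hok : ok (2 ^ m) t r 2 (row (2 ^ m) t r) 1 = false) : ¬ GoodT m t' := by
  intro hg
  have : ok (2 ^ m) t r 2 (row (2 ^ m) t r) 1 = true := by
    rw [ok_spec m t hm _ _ _ _ (row_lt _ _ _)]
    intro S hS hc
    right
    have hrS : r ∉ S := fun e => by simpa using hS e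
    have h2 := hg (insert r S) (by
      intro a ha
      rcases Finset.mem_insert.1 ha with rfl | ha
      · simpa using hr
      · have := Finset.mem_range.1 (hS ha)
        exact Finset.mem_range.2 (by omega)) (Finset.insert_ne_empty _ _)
    rw [Finset.card_insert_of_notMem hrS] at h2
    have h3 : yw m t' 0 (insert r S) = yw m t (row (2 ^ m) t r) S := by
      unfold yw
      congr 1
      apply Finset.filter_congr
      intro j hj
      have hj := Finset.mem_range.1 hj
      rw [bt_zero, zero_add, Finset.sum_insert hrS, bt_row _ _ _ _ hj,
        bt_congr t t' _ (j + r) h (by omega)]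
      rw [Finset.sum_congr rfl (fun k hk => bt_congr t t' _ (j + k) h (by
        have := Finset.mem_range.1 (hS hk); omega))]
    omega
  rw [hok] at this
  cases this

lemma go_spec (m : ℕ) (hm0 : 1 ≤ m) (hm : m ≤ 28) : ∀ f n t, n + f = 2 * m - 1 → t < 2 ^ n →
    go (2 ^ m) m f n t = true → ∀ t', t' % 2 ^ n = t → ¬ GoodT m t'
  | 0, n, t, hn, hlt, h, t', ht => by
      rw [go, Bool.not_eq_true'] at h
      refine not_good_of_ok m t t' (n - m) hm (by omega) ?_ h
      rw [show m + (n - m) = n by omega, ht, Nat.mod_eq_of_lt hlt]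
  | f + 1, n, t, hn, hlt, h, t', ht => by
      rw [go] at h
      cases hb : (Nat.ble m n &&
        not (ok (2 ^ m) t (Nat.sub n m) 2 (row (2 ^ m) t (Nat.sub n m)) 1))
      · rw [hb, cond_false, Bool.and_eq_true] at h
        have e : t' % 2 ^ (n + 1) = t' % 2 ^ n + 2 ^ n * (t' / 2 ^ n % 2) := by
          rw [pow_succ, Nat.mod_mul]
        have hp : (2 : ℕ) ^ (n + 1) = 2 ^ n * 2 := pow_succ _ _
        rcases Nat.mod_two_eq_zero_or_one (t' / 2 ^ n) with h3 | h3
        · exact go_spec m hm0 hm f (n + 1) t (by omega) (by omega) h.1 t'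
            (by rw [e, h3, ht]; simp)
        · exact go_spec m hm0 hm f (n + 1) (t + 2 ^ n) (by omega) (by omega) h.2 t'
            (by rw [e, h3, ht]; simp)
      · rw [Bool.and_eq_true, Bool.not_eq_true', Nat.ble_eq] at hb
        refine not_good_of_ok m t t' (n - m) hm (by omega) ?_ hb.2
        rw [show m + (n - m) = n by omega, ht, Nat.mod_eq_of_lt hlt]

lemma not_good (m M f : ℕ) (hm0 : 1 ≤ m) (hm : m ≤ 28) (hM : M = 2 ^ m) (hf : f = 2 * m - 1)
    (h : go M m f 0 0 = true) : ¬ Good m := by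
  intro hg
  obtain ⟨t, ht⟩ := goodT_of m hm0 hg
  subst hM
  exact go_spec m hm0 hm f 0 0 (by omega) (by norm_num) h t (by simp [Nat.mod_one]) ht

/-! ### Gilbert-Varshamov for large lengths -/

/-- Number of words of weight at most `7`. -/
def S7 (n : ℕ) : ℕ := ∑ i ∈ Finset.range 8, n.choose i

lemma choose3 (n i : ℕ) (hn : 56 ≤ n) (hi : i ≤ 6) : 3 * n.choose i ≤ n.choose (i + 1) := by
  have h := Nat.choose_succ_right_eq n i
  have : 3 * (i + 1) ≤ n - i := by omega
  have h2 : n.choose i * (3 * (i + 1)) ≤ n.choose (i + 1) * (i + 1) := by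
    rw [h]; exact Nat.mul_le_mul_left _ this
  have h3 : (3 * n.choose i) * (i + 1) ≤ n.choose (i + 1) * (i + 1) := by linarith
  exact Nat.le_of_mul_le_mul_right h3 (by omega)

lemma S7_step (n : ℕ) (hn : 56 ≤ n) : S7 (n + 2) ≤ 2 * S7 n := by
  have h0 := choose3 n 0 hn (by norm_num)
  have h1 := choose3 n 1 hn (by norm_num)
  have h2 := choose3 n 2 hn (by norm_num)
  have h3 := choose3 n 3 hn (by norm_num)
  have h4 := choose3 n 4 hn (by norm_num)
  have h5 := choose3 n 5 hn (by norm_num)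
  have h6 := choose3 n 6 hn (by norm_num)
  have p : ∀ k, (n + 2).choose (k + 2) = n.choose k + 2 * n.choose (k + 1) + n.choose (k + 2) := by
    intro k
    rw [Nat.choose_succ_succ (n + 1), Nat.choose_succ_succ n, Nat.choose_succ_succ n]
    simp only [Nat.succ_eq_add_one]; ring
  unfold S7
  simp only [Finset.sum_range_succ, Finset.sum_range_zero]
  rw [p 0, p 1, p 2, p 3, p 4, p 5]
  simp only [Nat.choose_zero_right, Nat.choose_one_right] at *
  norm_num at *
  omega

lemma S7_lt (m : ℕ) (hm : 29 ≤ m) : S7 (2 * m) < 2 ^ m := by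
  induction m, hm using Nat.le_induction with
  | base => decide +kernel
  | succ m hm ih =>
    have := S7_step (2 * m) (by omega)
    rw [pow_succ]
    rw [show 2 * (m + 1) = 2 * m + 2 by ring]
    omega

/-- Extension of a finite sequence by zero. -/
def ex {n : ℕ} (t : Fin n → ZMod 2) (p : ℕ) : ZMod 2 := if h : p < n then t ⟨p, h⟩ else 0

lemma window (m k0 : ℕ) (S : Finset ℕ) (hk : k0 ∈ S) (hmax : ∀ k ∈ S, k ≤ k0) (f g : ℕ → ZMod 2)
    (hout : ∀ p, p < k0 ∨ k0 + m ≤ p → f p = g p)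
    (heq : ∀ j < m, ∑ k ∈ S, f (j + k) = ∑ k ∈ S, g (j + k)) : ∀ p, f p = g p := by
  intro p
  induction p using Nat.strong_induction_on with
  | _ p ih =>
    by_cases h : p < k0 ∨ k0 + m ≤ p
    · exact hout p h
    · have h1 := heq (p - k0) (by omega)
      rw [← Finset.add_sum_erase _ _ hk, ← Finset.add_sum_erase _ _ hk,
        show p - k0 + k0 = p by omega] at h1
      have h2 : ∑ k ∈ S.erase k0, f (p - k0 + k) = ∑ k ∈ S.erase k0, g (p - k0 + k) := by
        apply Finset.sum_congr rfl
        intro k hk'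
        have h3 := Finset.mem_erase.1 hk'
        have := hmax k h3.2
        have := h3.1
        exact ih _ (by omega)
      rw [h2] at h1
      exact add_right_cancel h1

lemma fibre (m : ℕ) (x y : Fin m → ZMod 2) (hx : x ≠ 0) :
    (Finset.univ.filter (fun t : Fin (2 * m - 1) → ZMod 2 =>
      Matrix.vecMul x (T m (ex t)) = y)).card ≤ 2 ^ (m - 1) := by
  have hne : (supp x).Nonempty := by
    rw [Finset.nonempty_iff_ne_empty, Ne, supp_eq_empty]; exact hx
  obtain ⟨k0, hk0, hmax⟩ := (supp x).exists_max_image id hne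
  have hk0m := Finset.mem_range.1 (supp_sub x hk0)
  let φ : (Fin (2 * m - 1) → ZMod 2) → (Fin (m - 1) → ZMod 2) :=
    fun t q => ex t (if (q : ℕ) < k0 then q else q + m)
  have hcard : (Finset.univ : Finset (Fin (m - 1) → ZMod 2)).card = 2 ^ (m - 1) := by
    rw [Finset.card_univ, Fintype.card_fun, ZMod.card, Fintype.card_fin]
  rw [← hcard]
  apply Finset.card_le_card_of_injOn φ (fun _ _ => Finset.mem_coe.2 (Finset.mem_univ _))
  intro t ht s hs hts
  have ht := (Finset.mem_filter.1 (Finset.mem_coe.1 ht)).2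
  have hs := (Finset.mem_filter.1 (Finset.mem_coe.1 hs)).2
  have key := window m k0 (supp x) hk0 hmax (ex t) (ex s) (by
    intro p hp
    by_cases hp2 : p < 2 * m - 1
    · rcases hp with hp | hp
      · have := congrFun hts ⟨p, by omega⟩
        simpa [φ, hp] using this
      · have := congrFun hts ⟨p - m, by omega⟩
        simp only [φ] at this
        rw [if_neg (by omega), show p - m + m = p by omega] at this
        exact this
    · simp [ex, hp2]) (by
    intro j hj
    have := congrFun (ht.trans hs.symm) ⟨j, hj⟩
    rw [vecMul_T, vecMul_T] at this
    exact this)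
  funext p
  have := key p
  simpa [ex] using this

lemma low_card (ι : Type) [Fintype ι] [DecidableEq ι] :
    (Finset.univ.filter (fun c : ι → ZMod 2 =>
      (Finset.univ.filter (fun i => c i ≠ 0)).card ≤ 7)).card ≤ S7 (Fintype.card ι) := by
  have h : ((Finset.range 8).biUnion
      (fun i => Finset.powersetCard i (Finset.univ : Finset ι))).card ≤ S7 (Fintype.card ι) := by
    refine Finset.card_biUnion_le.trans ?_
    unfold S7
    apply Finset.sum_le_sum
    intro i _
    rw [Finset.card_powersetCard, Finset.card_univ]
  refine le_trans ?_ h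
  apply Finset.card_le_card_of_injOn (fun c => Finset.univ.filter (fun i => c i ≠ 0))
  · intro c hc
    have hc := (Finset.mem_filter.1 (Finset.mem_coe.1 hc)).2
    apply Finset.mem_coe.2
    rw [Finset.mem_biUnion]
    exact ⟨_, Finset.mem_range.2 (Nat.lt_succ_of_le hc), Finset.mem_powersetCard.2 ⟨Finset.subset_univ _, rfl⟩⟩
  · intro c _ d _ hcd
    funext i
    have := Finset.ext_iff.1 hcd i
    simp only [Finset.mem_filter, Finset.mem_univ, true_and] at this
    by_cases hc : c i = 0
    · by_cases hd : d i = 0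
      · rw [hc, hd]
      · exact absurd hc (this.2 hd)
    · rw [zmod2 _ hc, zmod2 _ (this.1 hc)]

lemma wt_eq' {ι : Type} [Fintype ι] (c : ι → ZMod 2) :
    wt c = (Finset.univ.filter (fun i => c i ≠ 0)).card := by
  unfold wt
  rw [Nat.card_eq_fintype_card, Fintype.card_subtype]

lemma good_gv (m : ℕ) (hm : 29 ≤ m) : Good m := by
  by_contra hbad
  let W := (Finset.univ.filter (fun c : Fin m ⊕ Fin m → ZMod 2 =>
      (Finset.univ.filter (fun i => c i ≠ 0)).card ≤ 7)).filter (fun c => c ∘ Sum.inl ≠ 0)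
  let F : (Fin m ⊕ Fin m → ZMod 2) → Finset (Fin (2 * m - 1) → ZMod 2) := fun c =>
    Finset.univ.filter (fun t => Matrix.vecMul (c ∘ Sum.inl) (T m (ex t)) = c ∘ Sum.inr)
  have hcov : (Finset.univ : Finset (Fin (2 * m - 1) → ZMod 2)) ⊆ W.biUnion F := by
    intro t _
    by_contra hnot
    apply hbad
    refine ⟨T m (ex t), T_toeplitz _ _, ?_⟩
    rintro c ⟨x, rfl⟩ hc
    by_contra hlt
    apply hnot
    rw [Finset.mem_biUnion]
    refine ⟨Sum.elim x (Matrix.vecMul x (T m (ex t))), ?_, ?_⟩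
    · simp only [W, Finset.mem_filter, Finset.mem_univ, true_and]
      rw [wt_eq'] at hlt
      refine ⟨by omega, ?_⟩
      rw [Sum.elim_comp_inl]
      rintro rfl
      apply hc
      funext i
      rcases i with i | i <;> simp
    · exact Finset.mem_filter.2 ⟨Finset.mem_univ _, rfl⟩
  have h1 := Finset.card_le_card hcov
  have h2 : (W.biUnion F).card ≤ W.card * 2 ^ (m - 1) := by
    apply Finset.card_biUnion_le_card_mul
    intro c hc
    exact fibre m _ _ (Finset.mem_filter.1 hc).2
  have h3 : W.card ≤ S7 (2 * m) := by
    refine (Finset.card_filter_le _ _).trans ?_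
    have := low_card (Fin m ⊕ Fin m)
    rwa [Fintype.card_sum, Fintype.card_fin, ← two_mul] at this
  have h4 := S7_lt m hm
  have h6 : 2 ^ (2 * m - 1) = 2 ^ m * 2 ^ (m - 1) := by
    rw [← pow_add]; congr 1; omega
  rw [Finset.card_univ, Fintype.card_fun, ZMod.card, Fintype.card_fin, h6] at h1
  have h5 : W.card * 2 ^ (m - 1) < 2 ^ m * 2 ^ (m - 1) :=
    Nat.mul_lt_mul_of_pos_right (by omega) (by positivity)
  omega

end DT

/-- Existence of a double Toeplitz code of length 2m over the field with 2
elements having minimum weight at least 8, characterized by the length. -/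
theorem stmt13 (m : ℕ) (hm : 1 ≤ m) :
    (∃ A : Matrix (Fin m) (Fin m) (ZMod 2), IsToeplitz A ∧
        ∀ c ∈ DTcode A, c ≠ 0 → 8 ≤ wt c) ↔ (2 * m = 24 ∨ 28 ≤ 2 * m) := by
  change DT.Good m ↔ _
  constructor
  · intro h
    by_contra hc
    have hm13 : m ≤ 13 := by omega
    interval_cases m
    · exact DT.not_good 1 2 1 (by norm_num) (by norm_num) (by norm_num) (by norm_num)
        (by decide +kernel) h
    · exact DT.not_good 2 4 3 (by norm_num) (by norm_num) (by norm_num) (by norm_num)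
        (by decide +kernel) h
    · exact DT.not_good 3 8 5 (by norm_num) (by norm_num) (by norm_num) (by norm_num)
        (by decide +kernel) h
    · exact DT.not_good 4 16 7 (by norm_num) (by norm_num) (by norm_num) (by norm_num)
        (by decide +kernel) h
    · exact DT.not_good 5 32 9 (by norm_num) (by norm_num) (by norm_num) (by norm_num)
        (by decide +kernel) h
    · exact DT.not_good 6 64 11 (by norm_num) (by norm_num) (by norm_num) (by norm_num)
        (by decide +kernel) h
    · exact DT.not_good 7 128 13 (by norm_num) (by norm_num) (by norm_num) (by norm_num)
        (by decide +kernel) h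
    · exact DT.not_good 8 256 15 (by norm_num) (by norm_num) (by norm_num) (by norm_num)
        (by decide +kernel) h
    · exact DT.not_good 9 512 17 (by norm_num) (by norm_num) (by norm_num) (by norm_num)
        (by decide +kernel) h
    · exact DT.not_good 10 1024 19 (by norm_num) (by norm_num) (by norm_num) (by norm_num)
        (by decide +kernel) h
    · exact DT.not_good 11 2048 21 (by norm_num) (by norm_num) (by norm_num) (by norm_num)
        (by decide +kernel) h
    · omega
    · exact DT.not_good 13 8192 25 (by norm_num) (by norm_num) (by norm_num) (by norm_num)
        (by decide +kernel) h
  · intro h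
    by_cases hm29 : 29 ≤ m
    · exact DT.good_gv m hm29
    · have hm28 : m ≤ 28 := by omega
      have hm12 : 12 ≤ m := by omega
      interval_cases m
      · exact DT.good_full 12 4096 379 3025 (by norm_num) (by norm_num) (by norm_num)
          (by decide +kernel)
      · omega
      · exact DT.good_full 14 16384 5349 4069 (by norm_num) (by norm_num) (by norm_num)
          (by decide +kernel)
      · exact DT.good_full 15 32768 1491 18920 (by norm_num) (by norm_num) (by norm_num)
          (by decide +kernel)
      · exact DT.good_full 16 65536 60027 45302 (by norm_num) (by norm_num) (by norm_num)
          (by decide +kernel)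
      · exact DT.good_full 17 131072 33257 80834 (by norm_num) (by norm_num) (by norm_num)
          (by decide +kernel)
      · exact DT.good_full 18 262144 18043 61998 (by norm_num) (by norm_num) (by norm_num)
          (by decide +kernel)
      · exact DT.good_full 19 524288 488895 454129 (by norm_num) (by norm_num) (by norm_num)
          (by decide +kernel)
      · exact DT.good_full 20 1048576 439591 196842 (by norm_num) (by norm_num) (by norm_num)
          (by decide +kernel)
      · exact DT.good_full 21 2097152 1190691 1574902 (by norm_num) (by norm_num) (by norm_num)
          (by decide +kernel)
      · exact DT.good_full 22 4194304 767591 4082032 (by norm_num) (by norm_num) (by norm_num)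
          (by decide +kernel)
      · exact DT.good_full 23 8388608 6064285 6732495 (by norm_num) (by norm_num) (by norm_num)
          (by decide +kernel)
      · exact DT.good_full 24 16777216 15060351 16607055 (by norm_num) (by norm_num) (by norm_num)
          (by decide +kernel)
      · exact DT.good_full 25 33554432 17855643 28209069 (by norm_num) (by norm_num) (by norm_num)
          (by decide +kernel)
      · exact DT.good_full 26 67108864 30039013 34111259 (by norm_num) (by norm_num) (by norm_num)
          (by decide +kernel)
      · exact DT.good_full 27 134217728 89436837 469501 (by norm_num) (by norm_num) (by norm_num)
          (by decide +kernel)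
      · exact DT.good_full 28 268435456 3009767 105482647 (by norm_num) (by norm_num) (by norm_num)
          (by decide +kernel)
end
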